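/- Pre-images of the boundary maps are intervals: in an ℓAQS-A with a loop (μ,ν), let μ_i be a D-boundary state and ν_j a U-boundary state, and suppose the pre-images ψ₋⁻¹(μ_i) (the set of U-boundary states mapped to μ_i by ψ₋) and ψ₊⁻¹(ν_j) are non-empty. Then (i) ψ₋⁻¹(μ_i) = [ν_{k'}, ν_k] and ψ₊⁻¹(ν_j) = [μ_{l'}, μ_l] are intervals of consecutive boundary states for some k' ≤ k and l' ≤ l; and (ii) the pairs (μ_i, ν_k) and (μ_{l'}, ν_j) are loops. -/

import Mathlib

/-- An AQS automaton: a set of configurations `S` with trapping fields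
`Fm, Fp : S → ℝ ∪ {−∞, +∞}` and maps `U, D : S → S` satisfying the AQS
compatibility conditions.  `U` has the unique fixed point `ω` with
`Fp ω = +∞` and `D` has the unique fixed point `α` with `Fm α = −∞`. -/
structure AQSA (S : Type*) where
  Fm : S → EReal
  Fp : S → EReal
  U : S → S
  D : S → S
  ω : S
  α : S
  lt_trap : ∀ σ, Fm σ < Fp σ
  Fp_U : ∀ σ, U σ ≠ σ → Fp σ < Fp (U σ)
  Fm_U : ∀ σ, Fm (U σ) < Fp σ
  Fm_D : ∀ σ, D σ ≠ σ → Fm (D σ) < Fm σ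
  Fp_D : ∀ σ, Fm σ < Fp (D σ)
  U_fix : U ω = ω
  U_fix_unique : ∀ σ, U σ = σ → σ = ω
  D_fix : D α = α
  D_fix_unique : ∀ σ, D σ = σ → σ = α
  Fp_omega : Fp ω = ⊤
  Fm_alpha : Fm α = ⊥

namespace AQSA

variable {S : Type*} (A : AQSA S)

/-- `A.inU μ ν` means `ν ∈ U*μ`, i.e. `ν` lies on the `U`-orbit of `μ`. -/
def inU (μ ν : S) : Prop := ∃ k : ℕ, A.U^[k] μ = ν

/-- `A.inD μ ν` means `μ ∈ D*ν`, i.e. `μ` lies on the `D`-orbit of `ν`. -/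
def inD (μ ν : S) : Prop := ∃ k : ℕ, A.D^[k] ν = μ

/-- `(μ, ν)` forms a loop: `ν ∈ U*μ` and `μ ∈ D*ν`. -/
def Loop (μ ν : S) : Prop := A.inU μ ν ∧ A.inD μ ν

/-- The loop return point memory (ℓRPM) property. -/
def lRPM : Prop :=
  (∀ (μ : S) (i j : ℕ), i ≤ j → A.inD μ (A.U^[j] μ) → A.inD μ (A.U^[i] μ)) ∧
  (∀ (ν : S) (i j : ℕ), i ≤ j → A.inU (A.D^[j] ν) ν → A.inU (A.D^[i] ν) ν)

/-- One step of the dynamics: `b = Ua` or `b = Da`. -/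
def Step (a b : S) : Prop := b = A.U a ∨ b = A.D a

/-- The set of reachable states: states connected to `α` by some field-history. -/
def Reach : Set S := {σ | Relation.ReflTransGen A.Step A.α σ}

/-- `σ` is reachable from an endpoint of the loop `(μ,ν)` by a `(μ,ν)`-confined
field-history: a finite sequence starting at `μ` or `ν`, each step is `U` or
`D`, and no intermediate state of the sequence equals `μ` or `ν`. -/
def ReachLoop (μ ν σ : S) : Prop :=
  ∃ (N : ℕ) (f : ℕ → S),
    (f 0 = μ ∨ f 0 = ν) ∧
    (∀ k < N, f (k + 1) = A.U (f k) ∨ f (k + 1) = A.D (f k)) ∧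
    (∀ k, 0 < k → k < N → f k ≠ μ ∧ f k ≠ ν) ∧
    f N = σ

/-- `x` is on the `U`-boundary of the loop `(a,b)`. -/
def onUB (a b x : S) : Prop := A.inU a x ∧ A.inU x b

/-- `x` is on the `D`-boundary of the loop `(a,b)`. -/
def onDB (a b x : S) : Prop := A.inD a x ∧ A.inD x b

/-- `x` is an interior state of the loop `(a,b)`: it is `(a,b)`-reachable and
lies on neither boundary. -/
def Interior (a b x : S) : Prop :=
  A.ReachLoop a b x ∧ ¬ A.onUB a b x ∧ ¬ A.onDB a b x

/-- `y = ψ₋(x)` for the loop with upper endpoint `ν`: `y` is the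
`⪯_D`-greatest element of `D*x ∩ D*ν`. -/
def IsPsiM (ν x y : S) : Prop :=
  (A.inD y x ∧ A.inD y ν) ∧ ∀ z, A.inD z x ∧ A.inD z ν → A.inD z y

/-- `y = ψ₊(x)` for the loop with lower endpoint `μ`: `y` is the
`⪯_U`-least element of `U*x ∩ U*μ`. -/
def IsPsiP (μ x y : S) : Prop :=
  (A.inU x y ∧ A.inU μ y) ∧ ∀ z, A.inU x z ∧ A.inU μ z → A.inU y z

/-- `𝒰[F]σ` : the first state along `σ, Uσ, U²σ, …` whose upper trapping
field exceeds `F`. -/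
noncomputable def Uact (F : ℝ) (σ : S) : S := by
  classical
  exact if h : ∃ i : ℕ, (F : EReal) < A.Fp (A.U^[i] σ) then A.U^[Nat.find h] σ else σ

/-- `𝒟[F]σ` : the first state along `σ, Dσ, D²σ, …` whose lower trapping
field is below `F`. -/
noncomputable def Dact (F : ℝ) (σ : S) : S := by
  classical
  exact if h : ∃ i : ℕ, A.Fm (A.D^[i] σ) < (F : EReal) then A.D^[Nat.find h] σ else σ

/-- A partial order `le` on `S` is compatible with `U` and `D`. -/
def Compatible (le : S → S → Prop) : Prop :=
  (∀ σ, le A.α σ ∧ le σ A.ω) ∧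
  (∀ σ, le σ (A.U σ)) ∧ (∀ σ, A.U σ = σ → σ = A.ω) ∧
  (∀ σ, le (A.D σ) σ) ∧ (∀ σ, A.D σ = σ → σ = A.α)

/-- The no-passing property with respect to a compatible partial order `le`. -/
def NoPassing (le : S → S → Prop) : Prop :=
  ∀ η σ : S, le η σ → ∀ F₁ F₂ : ℝ, F₁ ≤ F₂ →
    le (A.Uact F₁ η) (A.Uact F₂ σ) ∧ le (A.Dact F₁ η) (A.Dact F₂ σ)

/-- `(μ,ν)` is a maximal loop. -/
def MaxLoop (μ ν : S) : Prop :=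
  A.Loop μ ν ∧
  (∀ ν', A.inU ν ν' → ν' ≠ ν → ∀ σ, A.inD σ ν' → ¬ A.ReachLoop μ ν σ) ∧
  (∀ μ', A.inD μ' μ → μ' ≠ μ → ∀ σ, A.inU μ' σ → ¬ A.ReachLoop μ ν σ)

/-- The amplitudes `Fl < Fu` are `(μ,ν)`-traversing. -/
def Traversing (μ ν : S) (Fl Fu : ℝ) : Prop :=
  Fl < Fu ∧ A.Uact Fu μ = ν ∧ A.Dact Fl ν = μ

/-- The loop `(μ,ν)` is marginal. -/
def Marginal (μ ν : S) : Prop :=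
  ∀ Fl Fu : ℝ, A.Traversing μ ν Fl Fu →
    ∀ F : ℝ, Fl ≤ F → F ≤ Fu →
      A.Dact Fl (A.Uact F μ) = μ ∧ A.Uact Fu (A.Dact F ν) = ν

/-- The automaton exhibits marginal stability: every loop is marginal. -/
def MarginalStability : Prop := ∀ μ ν : S, A.Loop μ ν → A.Marginal μ ν

end AQSA

namespace AQSA

variable {S : Type*} {A : AQSA S}

/-- The automaton with the roles of `U` and `D` exchanged and the field reversed. -/
noncomputable def dual (A : AQSA S) : AQSA S where
  Fm σ := -A.Fp σ
  Fp σ := -A.Fm σ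
  U := A.D
  D := A.U
  ω := A.α
  α := A.ω
  lt_trap σ := EReal.neg_lt_neg_iff.2 (A.lt_trap σ)
  Fp_U σ h := EReal.neg_lt_neg_iff.2 (A.Fm_D σ h)
  Fm_U σ := EReal.neg_lt_neg_iff.2 (A.Fp_D σ)
  Fm_D σ h := EReal.neg_lt_neg_iff.2 (A.Fp_U σ h)
  Fp_D σ := EReal.neg_lt_neg_iff.2 (A.Fm_U σ)
  U_fix := A.D_fix
  U_fix_unique := A.D_fix_unique
  D_fix := A.U_fix
  D_fix_unique := A.U_fix_unique
  Fp_omega := by simp [A.Fm_alpha]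
  Fm_alpha := by simp [A.Fp_omega]

theorem inU_iterate_of_le (μ : S) {s t : ℕ} (h : s ≤ t) : A.inU (A.U^[s] μ) (A.U^[t] μ) :=
  ⟨t - s, by rw [← Function.iterate_add_apply, Nat.sub_add_cancel h]⟩

theorem inU.trans {x y z : S} (hxy : A.inU x y) (hyz : A.inU y z) : A.inU x z := by
  obtain ⟨a, rfl⟩ := hxy
  obtain ⟨b, rfl⟩ := hyz
  exact ⟨b + a, Function.iterate_add_apply _ _ _ _⟩

theorem inD.trans {x y z : S} (hxy : A.inD x y) (hyz : A.inD y z) : A.inD x z :=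
  inU.trans (A := A.dual) hyz hxy

theorem inU.total {x y z : S} (hy : A.inU x y) (hz : A.inU x z) : A.inU y z ∨ A.inU z y := by
  obtain ⟨a, rfl⟩ := hy
  obtain ⟨b, rfl⟩ := hz
  exact (le_total a b).imp (inU_iterate_of_le x) (inU_iterate_of_le x)

theorem inD.total {x y z : S} (hy : A.inD y x) (hz : A.inD z x) : A.inD z y ∨ A.inD y z :=
  inU.total (A := A.dual) hy hz

namespace lRPM

theorem dual (h : A.lRPM) : A.dual.lRPM := ⟨h.2, h.1⟩

theorem inD_of_between (h : A.lRPM) {μ σ ν : S} (hμσ : A.inU μ σ) (hσν : A.inU σ ν)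
    (hD : A.inD μ ν) : A.inD μ σ := by
  obtain ⟨i, rfl⟩ := hμσ
  obtain ⟨j, rfl⟩ := hσν
  rw [← Function.iterate_add_apply] at hD
  exact h.1 μ i (j + i) (Nat.le_add_left i j) hD

theorem inU_of_between (h : A.lRPM) {μ σ ν : S} (hμσ : A.inD μ σ) (hσν : A.inD σ ν)
    (hU : A.inU μ ν) : A.inU σ ν :=
  h.dual.inD_of_between (A := A.dual) hσν hμσ hU

/-- Moving up along the `U`-boundary of the loop `(μ, ν)` preserves the property of having a given
`D`-boundary state in the `D`-orbit. -/
theorem inD_of_inU (h : A.lRPM) {μ ν x x' z : S} (hμx : A.inU μ x) (hxx' : A.inU x x')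
    (hx'ν : A.inU x' ν) (hμz : A.inD μ z) (hzν : A.inD z ν) (hzx : A.inD z x) : A.inD z x' :=
  have hzx' := (h.inU_of_between hμz hzx hμx).trans hxx'
  h.inD_of_between hzx' hx'ν hzν

theorem isPsiM_of_between (h : A.lRPM) {μ ν x x' x'' y : S} (hμx : A.inU μ x)
    (hxx' : A.inU x x') (hx'' : A.inU x' x'') (hx''ν : A.inU x'' ν) (hμy : A.inD μ y)
    (hx : A.IsPsiM ν x y) (hy : A.IsPsiM ν x'' y) : A.IsPsiM ν x' y := by
  obtain ⟨⟨hyx, hyν⟩, -⟩ := hx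
  refine ⟨⟨h.inD_of_inU hμx hxx' (hx''.trans hx''ν) hμy hyν hyx, hyν⟩, fun z ⟨hzx', hzν⟩ ↦ ?_⟩
  obtain hzy | hyz := inD.total hyν hzν
  · exact hzy
  · exact hy.2 z
      ⟨h.inD_of_inU (hμx.trans hxx') hx'' hx''ν (hμy.trans hyz) hzν hzx', hzν⟩

theorem exists_isPsiM_iff_mem_interval (h : A.lRPM) {μ ν y : S} {n : ℕ} (hn : A.U^[n] μ = ν)
    (hμy : A.inD μ y) (hex : ∃ s ≤ n, A.IsPsiM ν (A.U^[s] μ) y) :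
    ∃ k' k, k' ≤ k ∧ k ≤ n ∧ (∀ s ≤ n, (A.IsPsiM ν (A.U^[s] μ) y ↔ k' ≤ s ∧ s ≤ k)) ∧
      A.Loop y (A.U^[k] μ) := by
  classical
  obtain ⟨s₀, hs₀, hψ₀⟩ := hex
  have hex' : ∃ s, A.IsPsiM ν (A.U^[s] μ) y := ⟨s₀, hψ₀⟩
  have hk' := Nat.find_spec hex'
  have hk := Nat.findGreatest_spec (P := fun s ↦ A.IsPsiM ν (A.U^[s] μ) y) hs₀ hψ₀
  refine ⟨Nat.find hex', Nat.findGreatest (fun s ↦ A.IsPsiM ν (A.U^[s] μ) y) n,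
    Nat.find_min' hex' hk, Nat.findGreatest_le n, fun s hs ↦ ⟨fun hψ ↦
      ⟨Nat.find_min' hex' hψ, Nat.le_findGreatest hs hψ⟩, fun ⟨h₁, h₂⟩ ↦ ?_⟩,
    h.inU_of_between hμy hk.1.1 ⟨_, rfl⟩, hk.1.1⟩
  exact h.isPsiM_of_between ⟨_, rfl⟩ (inU_iterate_of_le μ h₁) (inU_iterate_of_le μ h₂)
    (hn ▸ inU_iterate_of_le μ (Nat.findGreatest_le n)) hμy hk' hk

end lRPM

end AQSA

/-- Pre-images of the boundary maps are intervals of consecutive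
boundary states, and their extreme elements form loops with the image. -/
theorem psi_preimages_are_intervals {S : Type*} [Fintype S] (A : AQSA S)
    (hrpm : A.lRPM) (μ ν : S) (hl : A.Loop μ ν)
    (n m : ℕ) (hn : A.U^[n] μ = ν) (hn' : ∀ k < n, A.U^[k] μ ≠ ν)
    (hm : A.D^[m] ν = μ) (hm' : ∀ k < m, A.D^[k] ν ≠ μ)
    (i j : ℕ) (hi : i ≤ m) (hj : j ≤ n) :
    ((∃ s ≤ n, A.IsPsiM ν (A.U^[s] μ) (A.D^[m - i] ν)) →
      ∃ k' k, k' ≤ k ∧ k ≤ n ∧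
        (∀ s ≤ n, (A.IsPsiM ν (A.U^[s] μ) (A.D^[m - i] ν) ↔ k' ≤ s ∧ s ≤ k)) ∧
        A.Loop (A.D^[m - i] ν) (A.U^[k] μ)) ∧
    ((∃ t ≤ m, A.IsPsiP μ (A.D^[m - t] ν) (A.U^[j] μ)) →
      ∃ l' l, l' ≤ l ∧ l ≤ m ∧
        (∀ t ≤ m, (A.IsPsiP μ (A.D^[m - t] ν) (A.U^[j] μ) ↔ l' ≤ t ∧ t ≤ l)) ∧
        A.Loop (A.D^[m - l'] ν) (A.U^[j] μ)) := by
  constructor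
  · exact hrpm.exists_isPsiM_iff_mem_interval hn
      ⟨i, by rw [← Function.iterate_add_apply, Nat.add_sub_cancel' hi, hm]⟩
  · rintro ⟨t, ht, hψ⟩
    have hjν : A.inU (A.U^[j] μ) ν := hn ▸ AQSA.inU_iterate_of_le μ hj
    obtain ⟨k', k, hk'k, hkm, hiff, hloop⟩ :=
      hrpm.dual.exists_isPsiM_iff_mem_interval (A := A.dual) hm hjν ⟨m - t, Nat.sub_le m t, hψ⟩
    refine ⟨m - k, m - k', by lia, Nat.sub_le m k', fun t ht ↦ ?_, ?_⟩
    · exact (hiff (m - t) (Nat.sub_le m t)).trans (by lia)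
    · rw [Nat.sub_sub_self hkm]
      exact hloop.symm
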